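/- arXiv:2308.02450 — 2 statements merged into one kernel-verified Lean document; each statement's English description precedes it below -/
import Mathlib

section
/- Let ε be a real random variable whose cumulative distribution function F (F(x) = P(ε ≤ x)) is continuous, let τ ∈ (0,1), and let b, b₀ ∈ ℝ. Then the difference ρ_τ(ε − b) − ρ_τ(ε − b₀) is integrable and E[ρ_τ(ε − b) − ρ_τ(ε − b₀)] = (b − b₀)·(F(b₀) − τ) + ∫₀^{b−b₀} (F(b₀ + s) − F(b₀)) ds. -/
open MeasureTheory

/-- The check (quantile loss) function `ρ_τ(u) = u·(τ − 1{u ≤ 0})`. -/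
noncomputable def rho (τ u : ℝ) : ℝ := u * (τ - if u ≤ 0 then 1 else 0)

lemma rho_eq_mul_add_max (τ u : ℝ) : rho τ u = τ * u + max (-u) 0 := by
  unfold rho
  split_ifs with h
  · rw [max_eq_left (by linarith)]; ring
  · rw [max_eq_right (by linarith)]; ring

lemma integrable_rho_sub_rho {Ω : Type*} [MeasurableSpace Ω] {μ : Measure Ω} [IsFiniteMeasure μ]
    {ε : Ω → ℝ} (hε : Measurable ε) (τ b b₀ : ℝ) :
    Integrable (fun ω => rho τ (ε ω - b) - rho τ (ε ω - b₀)) μ := by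
  simp only [rho_eq_mul_add_max]
  refine Integrable.of_bound (by fun_prop) (|τ| * |b - b₀| + |b - b₀|) (.of_forall fun ω => ?_)
  have hmax := abs_max_sub_max_le_abs (-(ε ω - b)) (-(ε ω - b₀)) 0
  rw [show -(ε ω - b) - -(ε ω - b₀) = b - b₀ by ring] at hmax
  calc ‖_‖ = |-(τ * (b - b₀)) + (max (-(ε ω - b)) 0 - max (-(ε ω - b₀)) 0)| := by
        rw [Real.norm_eq_abs]; congr 1; ring
    _ ≤ _ := (abs_add_le _ _).trans (by rw [abs_neg, abs_mul]; gcongr)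

lemma intervalIntegrable_indicator_Ici (e a b : ℝ) :
    IntervalIntegrable ((Set.Ici e).indicator fun _ => (1 : ℝ)) volume a b := by
  rw [intervalIntegrable_iff]
  exact (integrableOn_const (by simp [Set.uIoc])).indicator measurableSet_Ici

lemma integral_indicator_Ici (e a b : ℝ) :
    ∫ x in a..b, (Set.Ici e).indicator (fun _ => (1 : ℝ)) x = max (b - e) 0 - max (a - e) 0 := by
  refine intervalIntegral.integral_eq_sub_of_hasDeriv_right
    (f := fun x => max (x - e) 0) (by fun_prop) (fun x _ => ?_)
    (intervalIntegrable_indicator_Ici e a b)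
  by_cases hx : e ≤ x
  · rw [Set.indicator_of_mem (Set.mem_Ici.2 hx)]
    refine ((hasDerivAt_id x).sub_const e).hasDerivWithinAt.congr (fun y hy => ?_) ?_
    · exact max_eq_left (sub_nonneg.2 (hx.trans (Set.mem_Ioi.1 hy).le))
    · exact max_eq_left (sub_nonneg.2 hx)
  · rw [Set.indicator_of_notMem (by simpa using hx)]
    refine ((hasDerivAt_const x (0 : ℝ)).congr_of_eventuallyEq ?_).hasDerivWithinAt
    filter_upwards [Iio_mem_nhds (not_le.1 hx)] with y hy
    exact max_eq_right (sub_nonpos.2 (Set.mem_Iio.1 hy).le)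

lemma integral_intervalIntegral_indicator_Ici {Ω : Type*} [MeasurableSpace Ω] {μ : Measure Ω}
    [IsFiniteMeasure μ] {ε : Ω → ℝ} (hε : Measurable ε) (a b : ℝ) :
    ∫ ω, (∫ x in a..b, (Set.Ici (ε ω)).indicator (fun _ => (1 : ℝ)) x) ∂μ =
      ∫ x in a..b, μ.real {ω | ε ω ≤ x} := by
  have hmeas : MeasurableSet {p : ℝ × Ω | ε p.2 ≤ p.1} :=
    measurableSet_le (by fun_prop) (by fun_prop)
  have : IsFiniteMeasure (volume.restrict (Set.uIoc a b)) := by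
    unfold Set.uIoc; infer_instance
  rw [← intervalIntegral_integral_swap]
  · congr 1 with x
    rw [← integral_indicator_one (measurableSet_le hε measurable_const)]
    rfl
  · exact (integrable_const (1 : ℝ)).indicator hmeas

/-- Expected-value form of Knight's identity: if `ε` has continuous cdf `F`, then
`ρ_τ(ε − b) − ρ_τ(ε − b₀)` is integrable with
`E[ρ_τ(ε − b) − ρ_τ(ε − b₀)] = (b − b₀)(F(b₀) − τ) + ∫₀^{b−b₀} (F(b₀+s) − F(b₀)) ds`. -/
theorem expected_knight_identity
    (Ω : Type*) [MeasurableSpace Ω] (μ : Measure Ω) [IsProbabilityMeasure μ]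
    (ε : Ω → ℝ) (hε : Measurable ε)
    (F : ℝ → ℝ) (hF : ∀ x, F x = (μ {ω | ε ω ≤ x}).toReal) (hFcont : Continuous F)
    (τ : ℝ) (hτ : τ ∈ Set.Ioo (0 : ℝ) 1) (b b₀ : ℝ) :
    Integrable (fun ω => rho τ (ε ω - b) - rho τ (ε ω - b₀)) μ ∧
    ∫ ω, (rho τ (ε ω - b) - rho τ (ε ω - b₀)) ∂μ =
      (b - b₀) * (F b₀ - τ) + ∫ s in (0 : ℝ)..(b - b₀), (F (b₀ + s) - F b₀) := by
  have hint := integrable_rho_sub_rho (μ := μ) hε τ b b₀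
  refine ⟨hint, ?_⟩
  have hpt (ω : Ω) : rho τ (ε ω - b) - rho τ (ε ω - b₀) + τ * (b - b₀) =
      ∫ x in b₀..b, (Set.Ici (ε ω)).indicator (fun _ => (1 : ℝ)) x := by
    rw [integral_indicator_Ici, rho_eq_mul_add_max, rho_eq_mul_add_max, neg_sub, neg_sub]
    ring
  have hsum := integral_add hint (integrable_const (τ * (b - b₀)))
  simp only [hpt, integral_intervalIntegral_indicator_Ici hε, integral_const, probReal_univ,
    one_smul] at hsum
  have hF' : ∫ x in b₀..b, μ.real {ω | ε ω ≤ x} = ∫ x in b₀..b, F x := by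
    simp only [hF, measureReal_def]
  have hshift := intervalIntegral.integral_comp_add_left (a := 0) (b := b - b₀)
    (fun x => F x - F b₀) b₀
  rw [hshift, add_zero, add_sub_cancel, intervalIntegral.integral_sub
    (hFcont.intervalIntegrable _ _) intervalIntegrable_const, intervalIntegral.integral_const,
    smul_eq_mul]
  linarith
end

section
/- Let ε be a real random variable, and let b, δ ∈ ℝ. Define the random variable X = ∫₀^δ (1{ε ≤ b + s} − 1{ε ≤ b}) ds, where the integral is the signed integral from 0 to δ. Then 0 ≤ X ≤ |δ| almost surely, and Var(X) ≤ 2|δ|·E[X]. -/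
open MeasureTheory ProbabilityTheory

theorem intervalIntegrable_knight_integrand (e b u v : ℝ) :
    IntervalIntegrable (fun s : ℝ =>
      ((if e ≤ b + s then (1 : ℝ) else 0) - (if e ≤ b then (1 : ℝ) else 0))) volume u v := by
  refine Monotone.intervalIntegrable fun s t hst => ?_
  split_ifs <;> linarith

theorem knight_integral_mem_Icc (e b δ : ℝ) :
    (∫ s in (0 : ℝ)..δ,
      ((if e ≤ b + s then (1 : ℝ) else 0) - (if e ≤ b then (1 : ℝ) else 0)))
      ∈ Set.Icc 0 |δ| := by
  rcases le_total 0 δ with h | h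
  · have hi := intervalIntegrable_knight_integrand e b 0 δ
    constructor
    · refine intervalIntegral.integral_nonneg h fun s hs => ?_
      have := hs.1
      split_ifs <;> linarith
    · have h1 := intervalIntegral.integral_mono_on (g := fun _ => (1 : ℝ)) h hi
        intervalIntegrable_const fun s _ => by split_ifs <;> norm_num
      simpa [abs_of_nonneg h] using h1
  · have hi := (intervalIntegrable_knight_integrand e b δ 0).neg
    rw [intervalIntegral.integral_symm, ← intervalIntegral.integral_neg]
    constructor
    · refine intervalIntegral.integral_nonneg h fun s hs => ?_
      have := hs.2
      split_ifs <;> linarith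
    · have h1 := intervalIntegral.integral_mono_on (g := fun _ => (1 : ℝ)) h hi
        intervalIntegrable_const fun s _ => by
          simp only [Pi.neg_apply]
          split_ifs <;> norm_num
      simpa [abs_of_nonpos h] using h1

theorem measurable_knight_integral (b δ : ℝ) :
    Measurable fun e : ℝ => ∫ s in (0 : ℝ)..δ,
      ((if e ≤ b + s then (1 : ℝ) else 0) - (if e ≤ b then (1 : ℝ) else 0)) := by
  have hf : StronglyMeasurable (Function.uncurry fun e s : ℝ =>
      ((if e ≤ b + s then (1 : ℝ) else 0) - (if e ≤ b then (1 : ℝ) else 0))) := by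
    refine Measurable.stronglyMeasurable (Measurable.sub ?_ ?_)
    · exact Measurable.ite (measurableSet_le measurable_fst (measurable_snd.const_add b))
        measurable_const measurable_const
    · exact Measurable.ite (measurableSet_le measurable_fst measurable_const)
        measurable_const measurable_const
  exact hf.integral_prod_right.measurable.sub hf.integral_prod_right.measurable

/-- A random variable with values in `[0, c]` satisfies `Var(X) ≤ c·E[X]`. -/
theorem variance_le_mul_integral_of_mem_Icc {Ω : Type*} [MeasurableSpace Ω] {μ : Measure Ω}
    [IsProbabilityMeasure μ] {X : Ω → ℝ} {c : ℝ} (hm : AEStronglyMeasurable X μ)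
    (hX : ∀ᵐ ω ∂μ, X ω ∈ Set.Icc 0 c) :
    variance X μ ≤ c * ∫ ω, X ω ∂μ := by
  have hb : ∀ᵐ ω ∂μ, ‖X ω‖ ≤ c := hX.mono fun ω h => by
    rw [Real.norm_of_nonneg h.1]
    exact h.2
  have hL : MemLp X 2 μ := MemLp.of_bound hm c hb
  calc variance X μ ≤ ∫ ω, (X ^ 2) ω ∂μ := variance_le_expectation_sq hm
    _ ≤ ∫ ω, c * X ω ∂μ := by
      refine integral_mono_ae hL.integrable_sq ((hL.integrable one_le_two).const_mul c) ?_
      filter_upwards [hX] with ω h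
      simpa [sq] using mul_le_mul_of_nonneg_right h.2 h.1
    _ = c * ∫ ω, X ω ∂μ := integral_const_mul c X

/-- The Knight remainder random variable
`X = ∫₀^δ (1{ε ≤ b + s} − 1{ε ≤ b}) ds` satisfies `0 ≤ X ≤ |δ|` almost surely and
`Var(X) ≤ 2|δ|·E[X]`. -/
theorem knight_remainder_variance_bound
    (Ω : Type*) [MeasurableSpace Ω] (μ : Measure Ω) [IsProbabilityMeasure μ]
    (ε : Ω → ℝ) (hε : Measurable ε) (b δ : ℝ)
    (X : Ω → ℝ)
    (hX : ∀ ω, X ω = ∫ s in (0 : ℝ)..δ,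
        ((if ε ω ≤ b + s then (1 : ℝ) else 0) - (if ε ω ≤ b then (1 : ℝ) else 0))) :
    (∀ᵐ ω ∂μ, 0 ≤ X ω ∧ X ω ≤ |δ|) ∧
    variance X μ ≤ 2 * |δ| * ∫ ω, X ω ∂μ := by
  have hb : ∀ ω, X ω ∈ Set.Icc 0 |δ| := fun ω => hX ω ▸ knight_integral_mem_Icc (ε ω) b δ
  have hm : Measurable X := by
    rw [funext hX]
    exact (measurable_knight_integral b δ).comp hε
  refine ⟨.of_forall hb, ?_⟩
  have hv := variance_le_mul_integral_of_mem_Icc hm.aestronglyMeasurable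
    (Filter.Eventually.of_forall (f := ae μ) hb)
  have hE : 0 ≤ ∫ ω, X ω ∂μ := integral_nonneg fun ω => (hb ω).1
  nlinarith [mul_nonneg (abs_nonneg δ) hE]
end
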